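/- arXiv:1604.00779 — 3 statements merged into one kernel-verified Lean document; each statement's English description precedes it below -/
import Mathlib

section
/- Let α ≥ 0, β > 0 and f(k) = k/2 + (α/2)·k/log(k ∨ e) + β for k ∈ ℕ₀. Define μ_k = (1/(1+f(k)))·∏_{j=0}^{k−1} f(j)/(1+f(j)) for k ∈ ℕ₀. Then there is a constant C > 0 such that |log μ_k + 3 log k − 2α log log k| ≤ C for all integers k ≥ 3; in other words, log μ_k = −3 log k + 2α log log k + O(1) as k → ∞. -/
/-- The attachment rule `f(k) = k/2 + (α/2)·k/log(k ∨ e) + β`. -/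
noncomputable def fPA (α β : ℝ) (k : ℕ) : ℝ :=
  (k : ℝ) / 2 + α / 2 * (k : ℝ) / Real.log (max (k : ℝ) (Real.exp 1)) + β

/-- The asymptotic indegree distribution `μ_k`. -/
noncomputable def muPA (α β : ℝ) (k : ℕ) : ℝ :=
  (1 / (1 + fPA α β k)) * ∏ j ∈ Finset.range k, fPA α β j / (1 + fPA α β j)

lemma abs_log_one_add_sub_le {x : ℝ} (hx : 0 ≤ x) : |Real.log (1 + x) - x| ≤ x ^ 2 := by
  have h₁ := Real.log_le_sub_one_of_pos (show 0 < 1 + x by linarith)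
  have h₂ := Real.one_sub_inv_le_log_of_pos (show 0 < 1 + x by linarith)
  have h₃ : x - x ^ 2 ≤ 1 - (1 + x)⁻¹ := by
    have : 1 - (1 + x)⁻¹ - (x - x ^ 2) = x ^ 3 / (1 + x) := by
      field_simp
      ring
    have : 0 ≤ x ^ 3 / (1 + x) := by positivity
    linarith
  rw [abs_le]
  constructor <;> nlinarith [sq_nonneg x]

lemma one_le_log_natCast {k : ℕ} (hk : 3 ≤ k) : 1 ≤ Real.log (k : ℝ) := by
  have hk' : (3 : ℝ) ≤ k := by exact_mod_cast hk
  rw [Real.le_log_iff_exp_le (by linarith)]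
  linarith [Real.exp_one_lt_d9]

lemma fPA_pos {α β : ℝ} (hα : 0 ≤ α) (hβ : 0 < β) (k : ℕ) : 0 < fPA α β k := by
  have h : 0 ≤ Real.log (max (k : ℝ) (Real.exp 1)) :=
    Real.log_nonneg (le_max_of_le_right (Real.one_le_exp zero_le_one))
  unfold fPA
  positivity

lemma fPA_eq (α β : ℝ) {k : ℕ} (hk : 3 ≤ k) :
    fPA α β k = (k : ℝ) / 2 * (1 + (α / Real.log k + 2 * β / k)) := by
  have hk' : (3 : ℝ) ≤ k := by exact_mod_cast hk
  have hL := one_le_log_natCast hk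
  have hmax : max (k : ℝ) (Real.exp 1) = k :=
    max_eq_left (by linarith [Real.exp_one_lt_d9])
  rw [fPA, hmax]
  field_simp
  ring

lemma log_muPA {α β : ℝ} (hα : 0 ≤ α) (hβ : 0 < β) (k : ℕ) :
    Real.log (muPA α β k) =
      -Real.log (1 + fPA α β k) - ∑ j ∈ Finset.range k, Real.log (1 + 1 / fPA α β j) := by
  have hf := fPA_pos hα hβ
  have hpos (j : ℕ) : 0 < fPA α β j / (1 + fPA α β j) := by
    have := hf j
    positivity
  rw [muPA, Real.log_mul (by have := hf k; positivity)
    (Finset.prod_pos fun j _ => hpos j).ne', Real.log_prod fun j _ => (hpos j).ne',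
    one_div, Real.log_inv, sub_eq_add_neg, ← Finset.sum_neg_distrib]
  congr 1
  refine Finset.sum_congr rfl fun j _ => ?_
  have := hf j
  rw [← Real.log_inv]
  congr 1
  field_simp
  ring

lemma abs_log_one_add_fPA_sub_log_le {α β : ℝ} (hα : 0 ≤ α) (hβ : 0 < β) {k : ℕ} (hk : 3 ≤ k) :
    |Real.log (1 + fPA α β k) - Real.log k| ≤ Real.log (2 + α + 2 * β) := by
  have hk' : (3 : ℝ) ≤ k := by exact_mod_cast hk
  have hL := one_le_log_natCast hk
  have hf := fPA_pos hα hβ k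
  have h₁ : α / Real.log k ≤ α := div_le_self hα hL
  have h₀ : 0 ≤ α / Real.log k := by positivity
  have heq : fPA α β k = (k : ℝ) / 2 + k / 2 * (α / Real.log k) + β := by
    rw [fPA_eq α β hk]
    field_simp
    ring
  have h₂ : (k : ℝ) / 2 * (α / Real.log k) ≤ k / 2 * α := by gcongr
  have h₃ : 0 ≤ (k : ℝ) / 2 * (α / Real.log k) := by positivity
  rw [abs_le]
  constructor
  · have h : Real.log k ≤ Real.log ((2 + α + 2 * β) * (1 + fPA α β k)) :=
      Real.log_le_log (by positivity) (by nlinarith)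
    rw [Real.log_mul (by positivity) (by positivity)] at h
    linarith
  · have h : Real.log (1 + fPA α β k) ≤ Real.log ((2 + α + 2 * β) * k) :=
      Real.log_le_log (by positivity) (by nlinarith)
    rw [Real.log_mul (by positivity) (by positivity)] at h
    linarith

lemma abs_one_div_fPA_sub_le {α β : ℝ} (hα : 0 ≤ α) (hβ : 0 < β) {k : ℕ} (hk : 3 ≤ k) :
    |1 / fPA α β k - (2 / k - 2 * α / (k * Real.log k))| ≤
      (16 * β ^ 2 + 4 * β) * (1 / (k : ℝ) ^ 2) + 4 * α ^ 2 * (1 / (k * Real.log k ^ 2)) := by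
  have hk' : (3 : ℝ) ≤ k := by exact_mod_cast hk
  have hL := one_le_log_natCast hk
  set L := Real.log (k : ℝ)
  have hu : 0 ≤ α / L + 2 * β / k := by positivity
  rw [fPA_eq α β hk]
  have heq : 1 / ((k : ℝ) / 2 * (1 + (α / L + 2 * β / k))) - (2 / k - 2 * α / (k * L)) =
      2 / k * ((α / L + 2 * β / k) ^ 2 / (1 + (α / L + 2 * β / k))) - 4 * β * (1 / (k : ℝ) ^ 2) := by
    set u := α / L + 2 * β / k with hu_def
    have : 2 / (k : ℝ) - 2 * α / (k * L) = 2 / k * (1 - u) + 4 * β * (1 / (k : ℝ) ^ 2) := by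
      rw [hu_def]
      field_simp
      ring
    rw [this]
    field_simp
    ring
  rw [heq]
  have hv : (α / L + 2 * β / k) ^ 2 / (1 + (α / L + 2 * β / k)) ≤
      2 * (α / L) ^ 2 + 2 * (2 * β / k) ^ 2 :=
    (div_le_self (sq_nonneg _) (by linarith)).trans
      (by nlinarith [sq_nonneg (α / L - 2 * β / k)])
  have h₁ : 2 / (k : ℝ) * ((α / L + 2 * β / k) ^ 2 / (1 + (α / L + 2 * β / k))) ≤
      2 / k * (2 * (α / L) ^ 2 + 2 * (2 * β / k) ^ 2) := by gcongr
  have h₂ : 2 / (k : ℝ) * (2 * (α / L) ^ 2 + 2 * (2 * β / k) ^ 2) =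
      4 * α ^ 2 * (1 / (k * L ^ 2)) + 16 * β ^ 2 * (1 / (k : ℝ) ^ 2) * (1 / k) := by
    field_simp
    ring
  have h₃ : 16 * β ^ 2 * (1 / (k : ℝ) ^ 2) * (1 / k) ≤ 16 * β ^ 2 * (1 / (k : ℝ) ^ 2) :=
    mul_le_of_le_one_right (by positivity) (by rw [div_le_one (by linarith)]; linarith)
  have h₄ : 0 ≤ 2 / (k : ℝ) * ((α / L + 2 * β / k) ^ 2 / (1 + (α / L + 2 * β / k))) := by
    positivity
  have h₅ : 0 ≤ 4 * β * (1 / (k : ℝ) ^ 2) := by positivity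
  have h₆ : 0 ≤ 16 * β ^ 2 * (1 / (k : ℝ) ^ 2) := by positivity
  have h₇ : 0 ≤ 4 * α ^ 2 * (1 / (k * L ^ 2)) := by positivity
  rw [abs_le]
  constructor <;> linarith

lemma log_succ_eq {k : ℕ} (hk : 3 ≤ k) :
    Real.log ((k + 1 : ℕ) : ℝ) = Real.log k + Real.log (1 + 1 / k) := by
  have hk' : (3 : ℝ) ≤ k := by exact_mod_cast hk
  rw [← Real.log_mul (by positivity) (by positivity)]
  congr 1
  push_cast
  field_simp

lemma abs_log_log_succ_sub_le {k : ℕ} (hk : 3 ≤ k) :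
    |Real.log (Real.log ((k + 1 : ℕ) : ℝ)) - Real.log (Real.log k) - 1 / (k * Real.log k)| ≤
      2 * (1 / (k : ℝ) ^ 2) := by
  have hk' : (3 : ℝ) ≤ k := by exact_mod_cast hk
  have hL := one_le_log_natCast hk
  have hd := abs_log_one_add_sub_le (show 0 ≤ 1 / (k : ℝ) by positivity)
  have hd₀ : 0 ≤ Real.log (1 + 1 / (k : ℝ)) :=
    Real.log_nonneg (by linarith [show 0 ≤ 1 / (k : ℝ) by positivity])
  have hd₁ : Real.log (1 + 1 / (k : ℝ)) ≤ 1 / k := by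
    linarith [Real.log_le_sub_one_of_pos (show 0 < 1 + 1 / (k : ℝ) by positivity)]
  rw [log_succ_eq hk]
  set L := Real.log (k : ℝ)
  set d := Real.log (1 + 1 / (k : ℝ))
  have hy := abs_log_one_add_sub_le (show 0 ≤ d / L by positivity)
  have h₁ : L + d = L * (1 + d / L) := by field_simp
  rw [h₁, Real.log_mul (by positivity) (by positivity)]
  have h₂ : (d / L) ^ 2 ≤ (1 / (k : ℝ)) ^ 2 := by
    exact pow_le_pow_left₀ (by positivity) ((div_le_self hd₀ hL).trans hd₁) 2
  have h₃ : |d / L - 1 / (k * L)| ≤ (1 / (k : ℝ)) ^ 2 := by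
    have : d / L - 1 / (k * L) = (d - 1 / k) / L := by field_simp
    rw [this, abs_div, abs_of_nonneg (show 0 ≤ L by linarith)]
    exact (div_le_self (abs_nonneg _) hL).trans hd
  rw [one_div_pow] at h₂ h₃
  rw [abs_le] at *
  constructor <;> linarith

lemma one_div_sq_le_telescope {k : ℕ} (hk : 3 ≤ k) :
    1 / (k : ℝ) ^ 2 ≤ 2 * (1 / (k : ℝ) - 1 / ((k + 1 : ℕ) : ℝ)) := by
  have hk' : (3 : ℝ) ≤ k := by exact_mod_cast hk
  push_cast
  have : 2 * (1 / (k : ℝ) - 1 / (k + 1)) - 1 / (k : ℝ) ^ 2 = (k - 1) / (k ^ 2 * (k + 1)) := by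
    field_simp
    ring
  have : 0 ≤ ((k : ℝ) - 1) / (k ^ 2 * (k + 1)) := div_nonneg (by linarith) (by positivity)
  linarith

lemma one_div_mul_log_sq_le_telescope {k : ℕ} (hk : 3 ≤ k) :
    1 / (k * Real.log k ^ 2) ≤
      4 * (1 / Real.log k - 1 / Real.log ((k + 1 : ℕ) : ℝ)) := by
  have hk' : (3 : ℝ) ≤ k := by exact_mod_cast hk
  have hL := one_le_log_natCast hk
  have hd₁ : Real.log (1 + 1 / (k : ℝ)) ≤ 1 := by
    have : 1 / (k : ℝ) ≤ 1 := by rw [div_le_one (by linarith)]; linarith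
    linarith [Real.log_le_sub_one_of_pos (show 0 < 1 + 1 / (k : ℝ) by positivity)]
  have hd₂ : 1 / (2 * (k : ℝ)) ≤ Real.log (1 + 1 / (k : ℝ)) := by
    refine le_trans ?_ (Real.one_sub_inv_le_log_of_pos (by positivity))
    have : 1 - (1 + 1 / (k : ℝ))⁻¹ = 1 / (k + 1) := by
      field_simp
      ring
    rw [this]
    gcongr
    linarith
  rw [log_succ_eq hk]
  set L := Real.log (k : ℝ)
  set d := Real.log (1 + 1 / (k : ℝ))
  have hd₀ : 0 < d := lt_of_lt_of_le (by positivity) hd₂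
  have h : 4 * (1 / L - 1 / (L + d)) = 4 * (d / (L * (L + d))) := by
    field_simp
    ring
  have h' : 1 / (k * L ^ 2) = 4 * (1 / (2 * (k : ℝ)) / (L * (L + L))) := by
    field_simp
    ring
  rw [h, h']
  gcongr
  linarith

lemma abs_le_of_abs_succ_sub_le {b g : ℕ → ℝ} {m : ℕ} (hg : ∀ k, m ≤ k → 0 ≤ g k)
    (h : ∀ k, m ≤ k → |b (k + 1) - b k| ≤ g k - g (k + 1)) {k : ℕ} (hk : m ≤ k) :
    |b k| ≤ |b m| + g m := by
  suffices |b k| ≤ |b m| + g m - g k by linarith [hg k hk]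
  induction k, hk using Nat.le_induction with
  | base => simp
  | succ k hk ih => linarith [h k hk, abs_sub_abs_le_abs_sub (b (k + 1)) (b k)]

lemma exists_abs_sum_log_one_add_one_div_fPA_le {α β : ℝ} (hα : 0 ≤ α) (hβ : 0 < β) :
    ∃ C : ℝ, ∀ k : ℕ, 3 ≤ k →
      |∑ j ∈ Finset.range k, Real.log (1 + 1 / fPA α β j) - 2 * Real.log k
        + 2 * α * Real.log (Real.log k)| ≤ C := by
  let A := 16 * β ^ 2 + 4 * β + 6 + 4 * α
  let g : ℕ → ℝ := fun k => 2 * A * (1 / (k : ℝ)) + 16 * α ^ 2 * (1 / Real.log k)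
  refine ⟨_, fun k hk => abs_le_of_abs_succ_sub_le (b := fun k : ℕ =>
    ∑ j ∈ Finset.range k, Real.log (1 + 1 / fPA α β j) - 2 * Real.log k
      + 2 * α * Real.log (Real.log k)) (g := g) (fun k hk => ?_) (fun k hk => ?_) hk⟩
  · have hL := one_le_log_natCast hk
    positivity
  have hk' : (3 : ℝ) ≤ k := by exact_mod_cast hk
  have hL := one_le_log_natCast hk
  have hf := fPA_pos hα hβ k
  have hx : 1 / fPA α β k ≤ 2 / k := by
    rw [fPA_eq α β hk]
    have : 0 ≤ α / Real.log k + 2 * β / k := by positivity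
    calc 1 / ((k : ℝ) / 2 * (1 + (α / Real.log k + 2 * β / k))) ≤ 1 / ((k : ℝ) / 2) := by
          gcongr
          exact le_mul_of_one_le_right (by positivity) (by linarith)
      _ = 2 / k := by field_simp
  have h₁ := abs_log_one_add_sub_le (show 0 ≤ 1 / fPA α β k by positivity)
  have h₁' : (1 / fPA α β k) ^ 2 ≤ 4 * (1 / (k : ℝ) ^ 2) := by
    calc (1 / fPA α β k) ^ 2 ≤ (2 / (k : ℝ)) ^ 2 := by gcongr
      _ = 4 * (1 / (k : ℝ) ^ 2) := by ring
  have h₂ := abs_one_div_fPA_sub_le hα hβ hk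
  have h₃ := abs_log_one_add_sub_le (show 0 ≤ 1 / (k : ℝ) by positivity)
  rw [one_div_pow] at h₃
  have h₄ := mul_le_mul_of_nonneg_left (abs_log_log_succ_sub_le hk)
    (show 0 ≤ 2 * α by positivity)
  rw [← abs_of_nonneg (show 0 ≤ 2 * α by positivity), ← abs_mul,
    abs_of_nonneg (show 0 ≤ 2 * α by positivity)] at h₄
  have h₅ := mul_le_mul_of_nonneg_left (one_div_sq_le_telescope hk)
    (show 0 ≤ A by positivity)
  have h₆ := mul_le_mul_of_nonneg_left (one_div_mul_log_sq_le_telescope hk)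
    (show 0 ≤ 4 * α ^ 2 by positivity)
  have e₁ : 2 * α / (k * Real.log k) = 2 * α * (1 / (k * Real.log k)) := by ring
  have e₂ : 2 / (k : ℝ) = 2 * (1 / k) := by ring
  have e₃ := log_succ_eq hk
  rw [e₁, e₂] at h₂
  simp only [g, Finset.sum_range_succ]
  simp only [A] at h₅ ⊢
  rw [abs_le] at *
  constructor <;> linarith

theorem stmt2 (α β : ℝ) (hα : 0 ≤ α) (hβ : 0 < β) :
    ∃ C : ℝ, 0 < C ∧ ∀ k : ℕ, 3 ≤ k →
      |Real.log (muPA α β k) + 3 * Real.log (k : ℝ) - 2 * α * Real.log (Real.log (k : ℝ))| ≤ C := by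
  obtain ⟨C, hC⟩ := exists_abs_sum_log_one_add_one_div_fPA_le hα hβ
  refine ⟨max 1 (Real.log (2 + α + 2 * β) + C), by positivity, fun k hk => ?_⟩
  refine le_max_of_le_right ?_
  have h₁ := abs_log_one_add_fPA_sub_log_le hα hβ hk
  have h₂ := hC k hk
  rw [log_muPA hα hβ]
  rw [abs_le] at *
  constructor <;> linarith
end

section
/- Let f : ℕ₀ → (0,∞) be concave with f(i+1) − f(i) ≥ 1/2 for all i ∈ ℕ₀, let k, m ∈ ℕ and let (Z[m,n])_{n≥m} be a degree evolution with attachment rule f started at Z[m,m] = k. Define X(n) = f(Z[m,n])/ξ(m,n) and Y(n) = (f(Z[m,n])² + (1/2)·f(Z[m,n]))/(n/m). Then (X(n))_{n≥m} and (Y(n))_{n≥m} are submartingales with respect to the natural filtration of (Z[m,n]). If moreover f is affine of the form f(x) = x/2 + β with β > 0, then both X and Y are martingales. -/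
open MeasureTheory

/-- A degree evolution with attachment rule `f`, started at time `m` in state `k`:
a Markov chain on `ℕ` with increments in `{0,1}` and conditional jump probability
`f(Z[m,n])/n` given the past. -/
structure DegreeEvolution {Ω : Type} [MeasurableSpace Ω] (μ : Measure Ω)
    (f : ℕ → ℝ) (m k : ℕ) (Z : ℕ → Ω → ℕ) : Prop where
  measurable : ∀ n, Measurable (Z n)
  init : ∀ ω, Z m ω = k
  incr : ∀ n, m ≤ n → ∀ ω, Z (n + 1) ω = Z n ω ∨ Z (n + 1) ω = Z n ω + 1
  jump : ∀ n, m ≤ n → ∀ h : ℕ → ℕ,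
    μ ({ω | Z (n + 1) ω = Z n ω + 1} ∩ {ω | ∀ i, m ≤ i → i ≤ n → Z i ω = h i})
      = ENNReal.ofReal (f (h n) / (n : ℝ)) * μ {ω | ∀ i, m ≤ i → i ≤ n → Z i ω = h i}

/-- `ξ(m,n) = ∏_{i=m}^{n-1} (1 + 1/(2i))`. -/
noncomputable def xi (m n : ℕ) : ℝ := ∏ i ∈ Finset.Ico m n, (1 + 1 / (2 * (i : ℝ)))

/-- The natural filtration of the process `(Z[m,m+n])_{n≥0}`. -/
def natFilt {Ω : Type} [mΩ : MeasurableSpace Ω] (Z : ℕ → Ω → ℕ)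
    (hZ : ∀ n, Measurable (Z n)) (m : ℕ) : Filtration ℕ mΩ where
  seq n := ⨆ i ∈ Set.Iic n, MeasurableSpace.comap (Z (m + i)) inferInstance
  mono' := fun a b hab => by
    refine biSup_mono fun i hi => ?_
    exact le_trans hi hab
  le' := fun n => by
    refine iSup₂_le fun i _ => ?_
    exact (hZ (m + i)).comap_le

namespace DegreeEvolution

variable {Ω : Type} [mΩ : MeasurableSpace Ω] {μ : Measure Ω} {f : ℕ → ℝ} {m k : ℕ}
  {Z : ℕ → Ω → ℕ}

theorem le_add (hZ : DegreeEvolution μ f m k Z) (n : ℕ) (ω : Ω) : Z (m + n) ω ≤ k + n := by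
  induction n with
  | zero => simp [hZ.init ω]
  | succ n ih =>
    have := hZ.incr (m + n) (Nat.le_add_right _ _) ω
    rw [← add_assoc]
    omega

theorem integrable_comp [IsFiniteMeasure μ] (hZ : DegreeEvolution μ f m k Z) (F : ℕ → ℝ) (n : ℕ) :
    Integrable (fun ω => F (Z (m + n) ω)) μ := by
  refine Integrable.of_bound
    ((measurable_of_countable F).comp (hZ.measurable (m + n))).aestronglyMeasurable
    (∑ i ∈ Finset.range (k + n + 1), ‖F i‖) (Filter.Eventually.of_forall fun ω => ?_)
  exact Finset.single_le_sum (f := fun i => ‖F i‖) (fun i _ => norm_nonneg _)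
    (Finset.mem_range.2 (Nat.lt_succ_of_le (hZ.le_add n ω)))

theorem measurableSet_path (hZ : DegreeEvolution μ f m k Z) (n : ℕ) (h : ℕ → ℕ) :
    MeasurableSet {ω | ∀ i, m ≤ i → i ≤ n → Z i ω = h i} := by
  have : {ω | ∀ i, m ≤ i → i ≤ n → Z i ω = h i}
      = ⋂ i, ⋂ (_ : m ≤ i), ⋂ (_ : i ≤ n), Z i ⁻¹' {h i} := by
    ext ω
    simp
  rw [this]
  exact MeasurableSet.iInter fun i => MeasurableSet.iInter fun _ => MeasurableSet.iInter fun _ =>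
    hZ.measurable i (measurableSet_singleton _)

/-- The one-step transition formula, integrated over the event of a fixed path. -/
theorem setIntegral_path [IsFiniteMeasure μ] (hfpos : ∀ i, 0 < f i)
    (hZ : DegreeEvolution μ f m k Z) (F : ℕ → ℝ) (n : ℕ) (h : ℕ → ℕ) :
    ∫ ω in {ω | ∀ i, m ≤ i → i ≤ m + n → Z i ω = h i}, F (Z (m + (n + 1)) ω) ∂μ
      = ∫ ω in {ω | ∀ i, m ≤ i → i ≤ m + n → Z i ω = h i}, (F (Z (m + n) ω)
        + (F (Z (m + n) ω + 1) - F (Z (m + n) ω)) * (f (Z (m + n) ω) / ((m + n : ℕ) : ℝ))) ∂μ := by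
  set A := {ω | ∀ i, m ≤ i → i ≤ m + n → Z i ω = h i} with hA
  set J := {ω | Z (m + n + 1) ω = Z (m + n) ω + 1} with hJ
  set a := h (m + n)
  have hmA : MeasurableSet A := hZ.measurableSet_path _ h
  have hmJ : MeasurableSet J :=
    measurableSet_eq_fun (hZ.measurable _) ((hZ.measurable _).add_const 1)
  have hlast : ∀ ω ∈ A, Z (m + n) ω = a := fun ω hω => hω _ (Nat.le_add_right _ _) le_rfl
  have hleft : ∫ ω in A, F (Z (m + (n + 1)) ω) ∂μ
      = ∫ ω in A, (F a + J.indicator (fun _ => F (a + 1) - F a) ω) ∂μ := by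
    refine setIntegral_congr_fun hmA fun ω hω => ?_
    have h0 := hlast ω hω
    by_cases hωJ : ω ∈ J
    · have h1 : Z (m + n + 1) ω = a + 1 := by rw [← h0]; exact hωJ
      simp [hωJ, ← add_assoc, h1]
    · have h1 : Z (m + n + 1) ω = a :=
        h0 ▸ (hZ.incr (m + n) (Nat.le_add_right _ _) ω).resolve_right hωJ
      simp [hωJ, ← add_assoc, h1]
  have hright : ∫ ω in A, (F (Z (m + n) ω)
        + (F (Z (m + n) ω + 1) - F (Z (m + n) ω)) * (f (Z (m + n) ω) / ((m + n : ℕ) : ℝ))) ∂μ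
      = ∫ ω in A, (F a + (F (a + 1) - F a) * (f a / ((m + n : ℕ) : ℝ))) ∂μ :=
    setIntegral_congr_fun hmA fun ω hω => by simp only [hlast ω hω]
  have hjump : μ.real (J ∩ A) = f a / ((m + n : ℕ) : ℝ) * μ.real A := by
    rw [Measure.real, hZ.jump (m + n) (Nat.le_add_right _ _) h, ENNReal.toReal_mul,
      ENNReal.toReal_ofReal (div_nonneg (hfpos _).le (Nat.cast_nonneg _))]
    rfl
  rw [hleft, hright, integral_add (integrable_const _) ((integrable_const _).indicator hmJ),
    integral_indicator_const _ hmJ, setIntegral_const, setIntegral_const,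
    measureReal_restrict_apply hmJ, hjump]
  simp only [smul_eq_mul]
  ring

theorem natFilt_le_comap (hZ : ∀ n, Measurable (Z n)) (n : ℕ) :
    (natFilt Z hZ m n : MeasurableSpace Ω)
      ≤ MeasurableSpace.comap (fun ω (i : Fin (n + 1)) => Z (m + i) ω) ⊤ := by
  refine iSup₂_le fun i hi => ?_
  rintro s ⟨t, -, rfl⟩
  exact ⟨(fun p : Fin (n + 1) → ℕ => p ⟨i, Nat.lt_succ_of_le hi⟩) ⁻¹' t, trivial, rfl⟩

/-- The one-step transition formula, integrated over an event of the past. -/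
theorem setIntegral_succ [IsFiniteMeasure μ] (hfpos : ∀ i, 0 < f i)
    (hZ : DegreeEvolution μ f m k Z) (F : ℕ → ℝ) (n : ℕ) {s : Set Ω}
    (hs : MeasurableSet[natFilt Z hZ.measurable m n] s) :
    ∫ ω in s, F (Z (m + (n + 1)) ω) ∂μ
      = ∫ ω in s, (F (Z (m + n) ω)
        + (F (Z (m + n) ω + 1) - F (Z (m + n) ω)) * (f (Z (m + n) ω) / ((m + n : ℕ) : ℝ))) ∂μ := by
  obtain ⟨B, -, rfl⟩ := natFilt_le_comap hZ.measurable n s hs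
  set P : Ω → Fin (n + 1) → ℕ := fun ω i => Z (m + i) ω
  have hpath : ∀ p : Fin (n + 1) → ℕ, ∃ h : ℕ → ℕ,
      P ⁻¹' {p} = {ω | ∀ i, m ≤ i → i ≤ m + n → Z i ω = h i} := by
    refine fun p => ⟨fun i => if hi : i - m < n + 1 then p ⟨i - m, hi⟩ else 0, ?_⟩
    ext ω
    simp only [Set.mem_preimage, Set.mem_singleton_iff, Set.mem_ofPred_eq]
    constructor
    · rintro rfl i h1 h2
      have hi : i - m < n + 1 := by omega
      simp [P, hi, Nat.add_sub_cancel' h1]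
    · intro H
      funext i
      simpa [P, Nat.le_of_lt_succ i.isLt] using H (m + i) (Nat.le_add_right _ _) (by omega)
  have hB : P ⁻¹' B = ⋃ p : B, P ⁻¹' {(p : Fin (n + 1) → ℕ)} := by
    ext ω
    simp
  have hmeas : ∀ p : B, MeasurableSet (P ⁻¹' {(p : Fin (n + 1) → ℕ)}) := fun p => by
    obtain ⟨h, hh⟩ := hpath p
    exact hh ▸ hZ.measurableSet_path _ h
  have hdisj : Pairwise (Function.onFun Disjoint
      fun p : B => P ⁻¹' {(p : Fin (n + 1) → ℕ)}) := fun p q hpq =>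
    Disjoint.preimage _ (Set.disjoint_singleton.2 fun h => hpq (Subtype.ext h))
  rw [hB, integral_iUnion hmeas hdisj (hZ.integrable_comp F (n + 1)).integrableOn,
    integral_iUnion hmeas hdisj (hZ.integrable_comp
      (fun z => F z + (F (z + 1) - F z) * (f z / ((m + n : ℕ) : ℝ))) n).integrableOn]
  refine tsum_congr fun p => ?_
  obtain ⟨h, hh⟩ := hpath p
  rw [hh]
  exact hZ.setIntegral_path hfpos F n h

theorem stronglyAdapted_comp (hZ : ∀ n, Measurable (Z n)) (F : ℕ → ℕ → ℝ) :
    StronglyAdapted (natFilt Z hZ m) fun n ω => F n (Z (m + n) ω) := by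
  intro n
  have hle : MeasurableSpace.comap (Z (m + n)) inferInstance
      ≤ (natFilt Z hZ m n : MeasurableSpace Ω) :=
    le_iSup₂_of_le (f := fun i (_ : i ∈ Set.Iic n) =>
      MeasurableSpace.comap (Z (m + i)) inferInstance) n (le_refl n) le_rfl
  exact ((measurable_of_countable (F n)).comp
    ((comap_measurable (Z (m + n))).mono hle le_rfl)).stronglyMeasurable

theorem submartingale_comp [IsFiniteMeasure μ] (hfpos : ∀ i, 0 < f i)
    (hZ : DegreeEvolution μ f m k Z) (F : ℕ → ℕ → ℝ)
    (hF : ∀ n z, F n z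
      ≤ F (n + 1) z + (F (n + 1) (z + 1) - F (n + 1) z) * (f z / ((m + n : ℕ) : ℝ))) :
    Submartingale (fun n ω => F n (Z (m + n) ω)) (natFilt Z hZ.measurable m) μ := by
  refine submartingale_of_setIntegral_le_succ (stronglyAdapted_comp _ F)
    (fun n => hZ.integrable_comp (F n) n) fun n s hs => ?_
  rw [hZ.setIntegral_succ hfpos (F (n + 1)) n hs]
  exact setIntegral_mono (hZ.integrable_comp (F n) n).integrableOn
    (hZ.integrable_comp (fun z => F (n + 1) z
      + (F (n + 1) (z + 1) - F (n + 1) z) * (f z / ((m + n : ℕ) : ℝ))) n).integrableOn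
    fun ω => hF n _

theorem martingale_comp [IsFiniteMeasure μ] (hfpos : ∀ i, 0 < f i)
    (hZ : DegreeEvolution μ f m k Z) (F : ℕ → ℕ → ℝ)
    (hF : ∀ n z, F n z
      = F (n + 1) z + (F (n + 1) (z + 1) - F (n + 1) z) * (f z / ((m + n : ℕ) : ℝ))) :
    Martingale (fun n ω => F n (Z (m + n) ω)) (natFilt Z hZ.measurable m) μ := by
  refine martingale_of_setIntegral_eq_succ (stronglyAdapted_comp _ F)
    (fun n => hZ.integrable_comp (F n) n) fun n s hs => ?_
  rw [hZ.setIntegral_succ hfpos (F (n + 1)) n hs]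
  simp only [← hF]

end DegreeEvolution

theorem xi_pos (m n : ℕ) : 0 < xi m n :=
  Finset.prod_pos fun i _ => by positivity

theorem xi_succ {m n : ℕ} (h : m ≤ n) : xi m (n + 1) = xi m n * (1 + 1 / (2 * (n : ℝ))) :=
  Finset.prod_Ico_succ_top h _

/-- The drift of `f (Z n) / ξ(m,n)` over one step, as a multiple of `Δf - 1/2`. -/
theorem linear_drift_eq {c N x y : ℝ} (hc : 0 < c) (hN : 0 < N) :
    x / (c * (1 + 1 / (2 * N)))
        + (y / (c * (1 + 1 / (2 * N))) - x / (c * (1 + 1 / (2 * N)))) * (x / N)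
      = x / c + (y - x - 1 / 2) * (x / (N * (c * (1 + 1 / (2 * N))))) := by
  have : (2 * N + 1) ≠ 0 := by positivity
  field_simp
  ring

/-- The drift of `(f (Z n) ^ 2 + f (Z n) / 2) / (n / m)` over one step, as a multiple of
`Δf - 1/2`. -/
theorem quadratic_drift_eq {M N x y : ℝ} (hM : 0 < M) (hN : 0 < N) :
    (x ^ 2 + 1 / 2 * x) / ((N + 1) / M)
        + ((y ^ 2 + 1 / 2 * y) / ((N + 1) / M) - (x ^ 2 + 1 / 2 * x) / ((N + 1) / M)) * (x / N)
      = (x ^ 2 + 1 / 2 * x) / (N / M)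
        + (y - x - 1 / 2) * ((x + y + 1) * x * M / (N * (N + 1))) := by
  have : N + 1 ≠ 0 := by positivity
  field_simp
  ring

theorem stmt3 {Ω : Type} [mΩ : MeasurableSpace Ω] (μ : Measure Ω) [IsProbabilityMeasure μ]
    (f : ℕ → ℝ) (hfpos : ∀ i, 0 < f i)
    (hfconc : ∀ i, f (i + 2) - f (i + 1) ≤ f (i + 1) - f i)
    (hfstep : ∀ i, 1 / 2 ≤ f (i + 1) - f i)
    (m k : ℕ) (hm : 1 ≤ m) (hk : 1 ≤ k)
    (Z : ℕ → Ω → ℕ) (hZ : DegreeEvolution μ f m k Z)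
    (hbd : ∀ n, m ≤ n → ∀ᵐ ω ∂μ, f (Z n ω) ≤ (n : ℝ)) :
    Submartingale (fun n ω => f (Z (m + n) ω) / xi m (m + n)) (natFilt Z hZ.measurable m) μ
    ∧ Submartingale
        (fun n ω => (f (Z (m + n) ω) ^ 2 + 1 / 2 * f (Z (m + n) ω)) / (((m + n : ℕ) : ℝ) / (m : ℝ)))
        (natFilt Z hZ.measurable m) μ
    ∧ (∀ β : ℝ, 0 < β → (∀ x : ℕ, f x = (x : ℝ) / 2 + β) →
        Martingale (fun n ω => f (Z (m + n) ω) / xi m (m + n)) (natFilt Z hZ.measurable m) μ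
        ∧ Martingale
            (fun n ω => (f (Z (m + n) ω) ^ 2 + 1 / 2 * f (Z (m + n) ω))
              / (((m + n : ℕ) : ℝ) / (m : ℝ)))
            (natFilt Z hZ.measurable m) μ) := by
  have hM : (0 : ℝ) < m := by exact_mod_cast hm
  have hN : ∀ n, (0 : ℝ) < (m + n : ℕ) := fun n => by exact_mod_cast Nat.add_pos_left hm n
  have hX : ∀ n z, f z / xi m (m + (n + 1))
      + (f (z + 1) / xi m (m + (n + 1)) - f z / xi m (m + (n + 1))) * (f z / ((m + n : ℕ) : ℝ))
      = f z / xi m (m + n) + (f (z + 1) - f z - 1 / 2)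
        * (f z / ((m + n : ℕ) * xi m (m + (n + 1)))) := fun n z => by
    rw [← add_assoc, xi_succ (Nat.le_add_right m n)]
    exact linear_drift_eq (xi_pos _ _) (hN n)
  have hY : ∀ n z, (f z ^ 2 + 1 / 2 * f z) / (((m + (n + 1) : ℕ) : ℝ) / m)
      + ((f (z + 1) ^ 2 + 1 / 2 * f (z + 1)) / (((m + (n + 1) : ℕ) : ℝ) / m)
        - (f z ^ 2 + 1 / 2 * f z) / (((m + (n + 1) : ℕ) : ℝ) / m)) * (f z / ((m + n : ℕ) : ℝ))
      = (f z ^ 2 + 1 / 2 * f z) / (((m + n : ℕ) : ℝ) / m) + (f (z + 1) - f z - 1 / 2)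
        * ((f z + f (z + 1) + 1) * f z * m / ((m + n : ℕ) * ((m + n : ℕ) + 1))) := fun n z => by
    rw [← add_assoc, Nat.cast_succ (m + n)]
    exact quadratic_drift_eq hM (hN n)
  refine ⟨?_, ?_, fun β _ hf => ?_⟩
  · refine hZ.submartingale_comp hfpos (fun n z => f z / xi m (m + n)) fun n z => ?_
    rw [hX]
    exact le_add_of_nonneg_right (mul_nonneg (by linarith [hfstep z])
      (div_nonneg (hfpos z).le (mul_nonneg (hN n).le (xi_pos _ _).le)))
  · refine hZ.submartingale_comp hfpos
      (fun n z => (f z ^ 2 + 1 / 2 * f z) / (((m + n : ℕ) : ℝ) / m)) fun n z => ?_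
    rw [hY]
    have := hfpos z
    have := hfpos (z + 1)
    exact le_add_of_nonneg_right (mul_nonneg (by linarith [hfstep z]) (by positivity))
  · have hstep : ∀ z, f (z + 1) - f z - 1 / 2 = 0 := fun z => by
      rw [hf, hf]
      push_cast
      ring
    constructor
    · refine hZ.martingale_comp hfpos (fun n z => f z / xi m (m + n)) fun n z => ?_
      rw [hX, hstep, zero_mul, add_zero]
    · refine hZ.martingale_comp hfpos
        (fun n z => (f z ^ 2 + 1 / 2 * f z) / (((m + n : ℕ) : ℝ) / m)) fun n z => ?_
      rw [hY, hstep, zero_mul, add_zero]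
end

section
/- Let α ≥ 0. There are η ∈ (0,1) and c > 0, depending only on α, such that for all sufficiently large N the following holds: for any set A ⊂ {⌈2e²⌉,…,N} and any integer v₀ with v₀ < min( (min A)/e², η·N ) satisfying (log(N/min A) ∨ 1)^α · ∑_{a∈A} ξ(a,N)² ≤ (c/2)·N·(log(N/v₀))^{α+1}, one has, with V = {v₀, v₀+1,…,N} \ A and for every a ∈ A: ∑_{v∈V} (1/v)·(log((a∨v)/(a∧v)) ∨ 1)^α ≥ (c/2)·(log(N/v₀))^{α+1}. -/
theorem div_le_xi_sq {m n : ℕ} (hm : 1 ≤ m) (hmn : m ≤ n) : (n : ℝ) / m ≤ xi m n ^ 2 := by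
  have hm0 : (0 : ℝ) < m := by exact_mod_cast hm
  induction n, hmn using Nat.le_induction with
  | base => simp [xi, hm0.ne']
  | succ n hmn ih =>
    have hn0 : (0 : ℝ) < n := by exact_mod_cast hm.trans hmn
    have hxi : xi m (n + 1) = xi m n * (1 + 1 / (2 * (n : ℝ))) := by
      simp only [xi, Finset.prod_Ico_succ_top hmn]
    have hstep : 1 + 1 / (n : ℝ) ≤ (1 + 1 / (2 * (n : ℝ))) ^ 2 := by
      have : (1 + 1 / (2 * (n : ℝ))) ^ 2 = 1 + 1 / n + (1 / (2 * (n : ℝ))) ^ 2 := by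
        field_simp; ring
      rw [this]
      linarith [sq_nonneg (1 / (2 * (n : ℝ)))]
    calc ((n + 1 : ℕ) : ℝ) / m = n / m * (1 + 1 / n) := by push_cast; field_simp
      _ ≤ xi m n ^ 2 * (1 + 1 / (2 * (n : ℝ))) ^ 2 := by gcongr
      _ = xi m (n + 1) ^ 2 := by rw [hxi, mul_pow]

theorem log_sub_log_le_sum_inv {k : ℕ} (hk : 1 ≤ k) (n : ℕ) :
    Real.log (n + 1) - Real.log k ≤ ∑ v ∈ Finset.Icc k n, 1 / (v : ℝ) := by
  induction n with
  | zero =>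
    have h : 0 ≤ Real.log k := Real.log_nonneg (by exact_mod_cast hk)
    have : Finset.Icc k 0 = ∅ := Finset.Icc_eq_empty (by omega)
    simp [this, h]
  | succ n ih =>
    rcases le_or_gt k (n + 1) with h | h
    · have h0 : (0 : ℝ) < n + 1 := by positivity
      rw [Finset.sum_Icc_succ_top h]
      have h1 : Real.log (n + 1 + 1) - Real.log (n + 1) ≤ 1 / (n + 1) := by
        rw [← Real.log_div (by positivity) h0.ne']
        refine (Real.log_le_sub_one_of_pos (by positivity)).trans (le_of_eq ?_)
        field_simp
        ring
      push_cast
      linarith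
    · rw [Finset.Icc_eq_empty (by omega), Finset.sum_empty]
      have : Real.log ((n + 1 : ℕ) + 1 : ℝ) ≤ Real.log k :=
        Real.log_le_log (by positivity) (by exact_mod_cast h)
      linarith

theorem log_div_le_log_max_div_min {a v : ℕ} (ha : 1 ≤ a) (hv : 1 ≤ v) :
    Real.log ((a : ℝ) / v) ≤ Real.log (((max a v : ℕ) : ℝ) / ((min a v : ℕ) : ℝ)) := by
  have ha0 : (0 : ℝ) < a := by exact_mod_cast ha
  have hv0 : (0 : ℝ) < v := by exact_mod_cast hv
  have hmin : (0 : ℝ) < (min a v : ℕ) := by exact_mod_cast lt_min ha hv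
  refine Real.log_le_log (by positivity) ?_
  gcongr
  · exact le_max_left a v
  · exact min_le_right a v

/-- If the weights are at least `L / 4` on a set of harmonic mass at least `L / 8`, then the
weighted harmonic sum over any larger set is at least `(L / 8) ^ (α + 1)`. -/
theorem rpow_le_sum_of_subset {α L : ℝ} (hα : 0 ≤ α) (hL : 0 < L) {S T : Finset ℕ} (hTS : T ⊆ S)
    {w : ℕ → ℝ} (hw0 : ∀ v ∈ S, 0 ≤ w v) (hw : ∀ v ∈ T, L / 4 ≤ w v)
    (hT : L / 8 ≤ ∑ v ∈ T, 1 / (v : ℝ)) :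
    (L / 8) ^ (α + 1) ≤ ∑ v ∈ S, 1 / (v : ℝ) * w v ^ α := by
  calc (L / 8) ^ (α + 1) = L / 8 * (L / 8) ^ α := by
        rw [Real.rpow_add_one (by positivity), mul_comm]
    _ ≤ (∑ v ∈ T, 1 / (v : ℝ)) * (L / 8) ^ α := by gcongr
    _ = ∑ v ∈ T, 1 / (v : ℝ) * (L / 8) ^ α := by rw [Finset.sum_mul]
    _ ≤ ∑ v ∈ T, 1 / (v : ℝ) * w v ^ α := by
        refine Finset.sum_le_sum fun v hv => ?_
        have : L / 8 ≤ w v := by linarith [hw v hv]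
        gcongr
    _ ≤ ∑ v ∈ S, 1 / (v : ℝ) * w v ^ α :=
        Finset.sum_le_sum_of_subset_of_nonneg hTS fun v hv _ =>
          mul_nonneg (by positivity) (Real.rpow_nonneg (hw0 v hv) α)

theorem rpow_le_sum_Icc {α : ℝ} (hα : 0 ≤ α) {N a v₀ : ℕ} (hv₀ : 1 ≤ v₀) (hva : v₀ ≤ a)
    (haN : a ≤ N) (hL : 8 ≤ Real.log ((N : ℝ) / v₀)) :
    (Real.log ((N : ℝ) / v₀) / 8) ^ (α + 1) ≤ ∑ v ∈ Finset.Icc v₀ N,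
      1 / (v : ℝ) *
        (max (Real.log (((max a v : ℕ) : ℝ) / ((min a v : ℕ) : ℝ))) 1) ^ α := by
  set L := Real.log ((N : ℝ) / v₀) with hLdef
  have ha : 1 ≤ a := hv₀.trans hva
  have hv₀' : (0 : ℝ) < v₀ := by exact_mod_cast hv₀
  have ha' : (0 : ℝ) < a := by exact_mod_cast ha
  have hN' : (0 : ℝ) < N := by exact_mod_cast ha.trans haN
  have hLeq : L = Real.log N - Real.log v₀ := Real.log_div hN'.ne' hv₀'.ne'
  have hw0 : ∀ v ∈ Finset.Icc v₀ N,
      0 ≤ max (Real.log (((max a v : ℕ) : ℝ) / ((min a v : ℕ) : ℝ))) 1 :=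
    fun v _ => zero_le_one.trans (le_max_right _ _)
  rcases le_or_gt (L / 2) (Real.log a - Real.log v₀) with h | h
  · set x := (a : ℝ) * Real.exp (-(L / 4)) with hx
    have hx0 : 0 < x := by positivity
    have hlogx : Real.log x = Real.log a - L / 4 := by
      rw [hx, Real.log_mul ha'.ne' (Real.exp_pos _).ne', Real.log_exp]; ring
    have hxa : x ≤ a := mul_le_of_le_one_right ha'.le (Real.exp_le_one_iff.2 (by linarith))
    have hfl : ⌊x⌋₊ ≤ N := (Nat.floor_le_of_le hxa).trans haN
    refine rpow_le_sum_of_subset hα (by linarith) (Finset.Icc_subset_Icc le_rfl hfl) hw0 ?_ ?_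
    · intro v hv
      rw [Finset.mem_Icc] at hv
      have hv1 : 1 ≤ v := hv₀.trans hv.1
      have hv' : (0 : ℝ) < v := by exact_mod_cast hv1
      have hvx : Real.log v ≤ Real.log x := Real.log_le_log hv' ((Nat.le_floor_iff hx0.le).1 hv.2)
      have := log_div_le_log_max_div_min ha hv1
      rw [Real.log_div ha'.ne' hv'.ne'] at this
      exact le_max_of_le_left (by linarith)
    · have h1 := log_sub_log_le_sum_inv hv₀ ⌊x⌋₊
      have h2 : Real.log x ≤ Real.log (⌊x⌋₊ + 1) :=
        Real.log_le_log hx0 (Nat.lt_floor_add_one x).le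
      linarith
  · set x := (a : ℝ) * Real.exp (L / 4) with hx
    have hxa : (a : ℝ) ≤ x := le_mul_of_one_le_right ha'.le (Real.one_le_exp (by linarith))
    have hx0 : 0 < x := ha'.trans_le hxa
    have hx1 : 1 ≤ x := le_trans (by exact_mod_cast ha) hxa
    have hlogx : Real.log x = Real.log a + L / 4 := by
      rw [hx, Real.log_mul ha'.ne' (Real.exp_pos _).ne', Real.log_exp]
    have hac : a ≤ ⌈x⌉₊ := by exact_mod_cast hxa.trans (Nat.le_ceil x)
    refine rpow_le_sum_of_subset hα (by linarith)
      (Finset.Icc_subset_Icc (hva.trans hac) le_rfl) hw0 ?_ ?_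
    · intro v hv
      rw [Finset.mem_Icc] at hv
      have hv1 : 1 ≤ v := ha.trans (hac.trans hv.1)
      have hv' : (0 : ℝ) < v := by exact_mod_cast hv1
      have hvx : Real.log x ≤ Real.log v := Real.log_le_log hx0 (Nat.ceil_le.1 hv.1)
      have := log_div_le_log_max_div_min hv1 ha
      rw [Real.log_div hv'.ne' ha'.ne', max_comm, min_comm] at this
      exact le_max_of_le_left (by linarith)
    · have h1 := log_sub_log_le_sum_inv (ha.trans hac) N
      have h2 : Real.log N ≤ Real.log (N + 1) := Real.log_le_log hN' (by linarith)
      have h3 : Real.log ⌈x⌉₊ ≤ Real.log 2 + Real.log x := by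
        rw [← Real.log_mul two_ne_zero hx0.ne']
        refine Real.log_le_log (by exact_mod_cast ha.trans hac) ?_
        linarith [Nat.ceil_lt_add_one hx0.le]
      linarith [Real.log_two_lt_d9]

theorem stmt18 (α : ℝ) (hα : 0 ≤ α) :
    ∃ η : ℝ, η ∈ Set.Ioo (0 : ℝ) 1 ∧ ∃ c : ℝ, 0 < c ∧ ∃ N₀ : ℕ, ∀ N : ℕ, N₀ ≤ N →
      ∀ A : Finset ℕ, A ⊆ Finset.Icc (Nat.ceil (2 * Real.exp 1 ^ 2)) N → ∀ hA : A.Nonempty,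
      ∀ v₀ : ℕ, 1 ≤ v₀ →
        (v₀ : ℝ) < min (((A.min' hA : ℕ) : ℝ) / Real.exp 1 ^ 2) (η * (N : ℝ)) →
        (max (Real.log ((N : ℝ) / ((A.min' hA : ℕ) : ℝ))) 1) ^ α * ∑ a ∈ A, xi a N ^ 2
          ≤ c / 2 * (N : ℝ) * Real.log ((N : ℝ) / (v₀ : ℝ)) ^ (α + 1) →
        ∀ a ∈ A,
          c / 2 * Real.log ((N : ℝ) / (v₀ : ℝ)) ^ (α + 1)
            ≤ ∑ v ∈ Finset.Icc v₀ N \ A,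
                (1 : ℝ) / (v : ℝ) *
                  (max (Real.log (((max a v : ℕ) : ℝ) / ((min a v : ℕ) : ℝ))) 1) ^ α := by
  refine ⟨Real.exp (-8), ⟨Real.exp_pos _, by simp⟩, (1 / 8) ^ (α + 1),
    by positivity, 0, fun N _ A hAN hA v₀ hv₀ hlt hsum a ha => ?_⟩
  set m := A.min' hA with hm
  set M := max (Real.log ((N : ℝ) / (m : ℝ))) 1 with hM
  have hv₀' : (0 : ℝ) < v₀ := by exact_mod_cast hv₀
  obtain ⟨hvm, hvN⟩ := lt_min_iff.1 hlt
  have hvm' : v₀ ≤ m := by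
    have : (m : ℝ) / Real.exp 1 ^ 2 ≤ m :=
      div_le_self (by positivity) (one_le_pow₀ (Real.one_le_exp zero_le_one))
    exact_mod_cast (hvm.trans_le this).le
  have hm1 : 1 ≤ m := hv₀.trans hvm'
  have hm0 : (0 : ℝ) < m := by exact_mod_cast hm1
  have hAm : ∀ v ∈ A, m ≤ v := fun v hv => A.min'_le v hv
  have hAle : ∀ v ∈ A, v ≤ N := fun v hv => (Finset.mem_Icc.1 (hAN hv)).2
  have hN0 : (0 : ℝ) < N := by exact_mod_cast (hm1.trans (hAm a ha)).trans (hAle a ha)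
  have hL : 8 ≤ Real.log ((N : ℝ) / v₀) := by
    rw [Real.le_log_iff_exp_le (by positivity), le_div_iff₀ hv₀']
    have : Real.exp 8 * (Real.exp (-8) * N) = N := by
      rw [← mul_assoc, ← Real.exp_add]; simp
    calc Real.exp 8 * v₀ ≤ Real.exp 8 * (Real.exp (-8) * N) := by gcongr
      _ = N := this
  have hfull := rpow_le_sum_Icc hα hv₀ (hvm'.trans (hAm a ha)) (hAle a ha) hL
  have hsub : A ⊆ Finset.Icc v₀ N := fun v hv =>
    Finset.mem_Icc.2 ⟨hvm'.trans (hAm v hv), hAle v hv⟩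
  rw [← Finset.sum_sdiff hsub] at hfull
  have hc : (Real.log ((N : ℝ) / v₀) / 8) ^ (α + 1)
      = (1 / 8) ^ (α + 1) * Real.log ((N : ℝ) / v₀) ^ (α + 1) := by
    rw [← Real.mul_rpow (by norm_num) (by linarith)]
    congr 1
    ring
  have hM0 : 0 ≤ M ^ α := Real.rpow_nonneg (zero_le_one.trans (le_max_right _ _)) α
  have hremoved : ∑ v ∈ A, (1 : ℝ) / (v : ℝ) *
      (max (Real.log (((max a v : ℕ) : ℝ) / ((min a v : ℕ) : ℝ))) 1) ^ α
      ≤ M ^ α * ∑ v ∈ A, 1 / (v : ℝ) := by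
    rw [Finset.mul_sum]
    refine Finset.sum_le_sum fun v hv => ?_
    rw [mul_comm]
    have hmax : max a v ≤ N := max_le (hAle a ha) (hAle v hv)
    have hmin : m ≤ min a v := le_min (hAm a ha) (hAm v hv)
    have hmin0 : (0 : ℝ) < (min a v : ℕ) := by exact_mod_cast hm1.trans hmin
    have hmax0 : (0 : ℝ) < (max a v : ℕ) := by
      exact_mod_cast (hm1.trans (hAm a ha)).trans (le_max_left a v)
    have hlog : Real.log (((max a v : ℕ) : ℝ) / ((min a v : ℕ) : ℝ))
        ≤ Real.log ((N : ℝ) / (m : ℝ)) := by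
      refine Real.log_le_log (div_pos hmax0 hmin0) ?_
      exact div_le_div₀ hN0.le (by exact_mod_cast hmax) hm0 (by exact_mod_cast hmin)
    refine mul_le_mul_of_nonneg_right ?_ (by positivity)
    exact Real.rpow_le_rpow (zero_le_one.trans (le_max_right _ _)) (max_le_max_right 1 hlog) hα
  have hinv : N * ∑ v ∈ A, 1 / (v : ℝ) ≤ ∑ v ∈ A, xi v N ^ 2 := by
    rw [Finset.mul_sum]
    refine Finset.sum_le_sum fun v hv => ?_
    rw [mul_one_div]
    exact div_le_xi_sq (hm1.trans (hAm v hv)) (hAle v hv)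
  have hbound : M ^ α * ∑ v ∈ A, 1 / (v : ℝ)
      ≤ (1 / 8) ^ (α + 1) / 2 * Real.log ((N : ℝ) / v₀) ^ (α + 1) := by
    refine le_of_mul_le_mul_left ?_ hN0
    have := (mul_le_mul_of_nonneg_left hinv hM0).trans hsum
    linarith
  linarith
end
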